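/- Let c and a be positive integers. There exists a polyunsaturated poset P with height c and width a if and only if a ≥ c - 2. Moreover, P may be required to have order dimension at most 2. -/

import Mathlib

/-- The maximum cardinality of a union of `k` antichains (a `k`-family)
with respect to the relation `r`. -/
noncomputable def dFam {α : Type*} (r : α → α → Prop) (k : ℕ) : ℕ :=
  sSup {n | ∃ A : Fin k → Set α, (∀ i, IsAntichain r (A i)) ∧ (⋃ i, A i).ncard = n}

/-- The height of a poset: the maximum cardinality of a chain. -/
noncomputable def heightPO {α : Type*} (r : α → α → Prop) : ℕ :=
  sSup {n | ∃ s : Set α, IsChain r s ∧ s.ncard = n}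

/-- The width of a poset: the maximum cardinality of an antichain. -/
noncomputable def widthPO {α : Type*} (r : α → α → Prop) : ℕ :=
  sSup {n | ∃ s : Set α, IsAntichain r s ∧ s.ncard = n}

/-- `f` encodes a partition of `α` into chains: its (nonempty) fibers are the chains. -/
def IsChainPartition {α : Type*} (r : α → α → Prop) (f : α → α) : Prop :=
  ∀ i : α, IsChain r (f ⁻¹' {i})

/-- The `k`-norm of the partition encoded by `f`: `Σ_C min (k, |C|)`. -/
noncomputable def knorm {α : Type*} [Fintype α] (f : α → α) (k : ℕ) : ℕ :=
  ∑ i : α, min k (f ⁻¹' {i}).ncard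

/-- A poset is polyunsaturated if no chain partition is simultaneously `k`- and
`l`-saturated for distinct nonconsecutive positive `k, l` below the height. -/
def PolyunsatPO {α : Type*} [Fintype α] (r : α → α → Prop) : Prop :=
  ∀ k l : ℕ, 0 < k → 0 < l → k < heightPO r → l < heightPO r →
    (k + 2 ≤ l ∨ l + 2 ≤ k) →
    ¬ ∃ f : α → α, IsChainPartition r f ∧ knorm f k = dFam r k ∧ knorm f l = dFam r l

/-- A poset has order dimension at most 2: two linear extensions whose
intersection is the order. -/
def DimLE2 {α : Type*} (r : α → α → Prop) : Prop :=
  ∃ L₁ L₂ : α → α → Prop, IsLinearOrder α L₁ ∧ IsLinearOrder α L₂ ∧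
    (∀ x y, r x y → L₁ x y) ∧ (∀ x y, r x y → L₂ x y) ∧
    (∀ x y, r x y ↔ L₁ x y ∧ L₂ x y)

section General

variable {α : Type*} [Fintype α] {r : α → α → Prop}

theorem ncard_inter_chain_le {k : ℕ} {A : Fin k → Set α} (hA : ∀ i, IsAntichain r (A i))
    {s : Set α} (hs : IsChain r s) : (s ∩ ⋃ i, A i).ncard ≤ k := by
  rw [Set.inter_iUnion]
  refine (Set.ncard_iUnion_le_of_fintype _).trans ?_
  calc ∑ i, (s ∩ A i).ncard ≤ ∑ _i : Fin k, 1 := Finset.sum_le_sum fun i _ =>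
        Set.ncard_le_one_iff_subsingleton.2
          (inter_subsingleton_of_isChain_of_isAntichain hs (hA i))
    _ = k := by simp

theorem bddAbove_ncard (p : ℕ → Prop) (hp : ∀ n, p n → ∃ s : Set α, s.ncard = n) :
    BddAbove {n | p n} := by
  refine ⟨Nat.card α, fun n hn => ?_⟩
  obtain ⟨s, rfl⟩ := hp n hn
  exact Set.ncard_le_card s

theorem le_dFam {k : ℕ} {A : Fin k → Set α} (hA : ∀ i, IsAntichain r (A i)) :
    (⋃ i, A i).ncard ≤ dFam r k :=
  le_csSup (bddAbove_ncard _ fun _ ⟨_, _, h⟩ => ⟨_, h⟩) ⟨A, hA, rfl⟩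

theorem exists_eq_dFam (r : α → α → Prop) (k : ℕ) :
    ∃ A : Fin k → Set α, (∀ i, IsAntichain r (A i)) ∧ (⋃ i, A i).ncard = dFam r k :=
  Nat.sSup_mem (s := {n | ∃ A : Fin k → Set α, (∀ i, IsAntichain r (A i)) ∧
    (⋃ i, A i).ncard = n}) ⟨_, fun _ => ∅, fun _ => by simp [IsAntichain], rfl⟩
    (bddAbove_ncard _ fun _ ⟨_, _, h⟩ => ⟨_, h⟩)

theorem le_heightPO {s : Set α} (hs : IsChain r s) : s.ncard ≤ heightPO r :=
  le_csSup (bddAbove_ncard _ fun _ ⟨_, _, h⟩ => ⟨_, h⟩) ⟨s, hs, rfl⟩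

theorem exists_eq_heightPO (r : α → α → Prop) :
    ∃ s : Set α, IsChain r s ∧ s.ncard = heightPO r :=
  Nat.sSup_mem (s := {n | ∃ s : Set α, IsChain r s ∧ s.ncard = n})
    ⟨_, ∅, by simp [IsChain], rfl⟩ (bddAbove_ncard _ fun _ ⟨_, _, h⟩ => ⟨_, h⟩)

theorem le_widthPO {s : Set α} (hs : IsAntichain r s) : s.ncard ≤ widthPO r :=
  le_csSup (bddAbove_ncard _ fun _ ⟨_, _, h⟩ => ⟨_, h⟩) ⟨s, hs, rfl⟩

theorem exists_eq_widthPO (r : α → α → Prop) :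
    ∃ s : Set α, IsAntichain r s ∧ s.ncard = widthPO r :=
  Nat.sSup_mem (s := {n | ∃ s : Set α, IsAntichain r s ∧ s.ncard = n})
    ⟨_, ∅, by simp [IsAntichain], rfl⟩ (bddAbove_ncard _ fun _ ⟨_, _, h⟩ => ⟨_, h⟩)

theorem sum_ncard_inter_fiber (f : α → α) (s : Set α) :
    ∑ i, (f ⁻¹' {i} ∩ s).ncard = s.ncard := by
  classical
  rw [Set.ncard_eq_toFinset_card' s, Finset.card_eq_sum_card_fiberwise (f := f)
    (t := Finset.univ) (by simp)]
  refine Finset.sum_congr rfl fun i _ => ?_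
  rw [Set.ncard_eq_toFinset_card']
  congr 1
  ext x
  simp [and_comm]

/-- Weak duality between `k`-families and chain partitions. -/
theorem dFam_le_knorm {f : α → α} (hf : IsChainPartition r f) (k : ℕ) :
    dFam r k ≤ knorm f k := by
  obtain ⟨A, hA, hk⟩ := exists_eq_dFam r k
  rw [← hk, ← sum_ncard_inter_fiber f]
  exact Finset.sum_le_sum fun i _ => le_min (ncard_inter_chain_le hA (hf i))
    (Set.ncard_le_ncard Set.inter_subset_left)

theorem dFam_zero (r : α → α → Prop) : dFam r 0 = 0 := by
  obtain ⟨A, -, hk⟩ := exists_eq_dFam r 0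
  rw [← hk]
  simp

theorem dFam_one_le (r : α → α → Prop) : dFam r 1 ≤ widthPO r := by
  obtain ⟨A, hA, hk⟩ := exists_eq_dFam r 1
  rw [← hk]
  have : (⋃ i, A i) = A 0 := by
    ext x
    simp
  rw [this]
  exact le_widthPO (hA 0)

theorem dFam_lt_succ {k : ℕ} (hk : k < heightPO r) : dFam r k < dFam r (k + 1) := by
  obtain ⟨A, hA, hd⟩ := exists_eq_dFam r k
  obtain ⟨s, hs, hc⟩ := exists_eq_heightPO r
  have h1 := ncard_inter_chain_le hA hs
  obtain ⟨x, hx⟩ : ∃ x, x ∉ ⋃ i, A i := by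
    by_contra! h
    rw [Set.eq_univ_of_forall h, Set.inter_univ] at h1
    omega
  have h2 := le_dFam (r := r) (A := (Fin.cons {x} A : Fin (k + 1) → Set α)) (by
    intro i
    refine Fin.cases ?_ (fun j => ?_) i
    · simp
    · simpa using hA j)
  have h3 : (⋃ i, (Fin.cons {x} A : Fin (k + 1) → Set α) i) = insert x (⋃ i, A i) := by
    ext y
    simp
  rw [h3, Set.ncard_insert_of_notMem hx (Set.toFinite _)] at h2
  omega

/-- Egerváry's theorem: an assignment problem with nonnegative integer costs has a permutation
and an integral dual solution satisfying complementary slackness. -/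
theorem exists_perm_dual (w : α → α → ℤ) (hw : ∀ x y, 0 ≤ w x y) :
    ∃ (σ : α → α) (u v : α → ℤ), Function.Injective σ ∧ (∀ x y, u x + v y ≤ w x y) ∧
      ∀ x, u x + v (σ x) = w x (σ x) := by
  classical
  obtain ⟨m, ⟨u, v, hf, rfl⟩, hmax⟩ := Int.exists_greatest_of_bdd
    (P := fun z => ∃ u v : α → ℤ, (∀ x y, u x + v y ≤ w x y) ∧ ∑ x, (u x + v x) = z)
    ⟨∑ x, w x x, by
      rintro z ⟨u, v, h, rfl⟩
      exact Finset.sum_le_sum fun x _ => h x x⟩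
    ⟨0, 0, 0, by simpa using hw, by simp⟩
  let t : α → Finset α := fun x => {y | u x + v y = w x y}
  have hall : ∀ s : Finset α, s.card ≤ (s.biUnion t).card := by
    intro s
    have h := hmax _ ⟨fun x => u x + if x ∈ s then 1 else 0,
      fun y => v y - if y ∈ s.biUnion t then 1 else 0, fun x y => ?_, rfl⟩
    · simp only [Finset.sum_add_distrib, Finset.sum_sub_distrib, Finset.sum_ite_mem,
        Finset.univ_inter, Finset.sum_const, nsmul_eq_mul, mul_one] at h
      omega
    · have h := hf x y
      by_cases hx : x ∈ s
      · by_cases hy : y ∈ s.biUnion t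
        · simp [hx, hy]; omega
        · have : u x + v y ≠ w x y := fun hxy => hy (by
            simp only [Finset.mem_biUnion]; exact ⟨x, hx, by simp [t, hxy]⟩)
          simp only [hx, hy, if_true, if_false]; omega
      · simp only [hx, if_false]; split_ifs <;> omega
  obtain ⟨σ, hσ, hσt⟩ := (Finset.all_card_le_biUnion_card_iff_exists_injective t).1 hall
  exact ⟨σ, u, v, hσ, hf, fun x => by simpa [t] using hσt x⟩

open Classical in
/-- The cost of letting `y` follow `x` in a cyclic arrangement of disjoint chains: closing a
chain costs `k`, leaving an element uncovered costs `1`. -/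
noncomputable def linkCost (r : α → α → Prop) (k : ℕ) (x y : α) : ℤ :=
  if x = y then 1 else if r x y then 0 else k

theorem exists_cost_le_dFam (r : α → α → Prop) {k : ℕ} (hk : 0 < k) :
    ∃ σ : α → α, Function.Injective σ ∧ ∑ x, linkCost r k x (σ x) ≤ dFam r k := by
  classical
  obtain ⟨σ, u, v, hσ, hf, he⟩ := exists_perm_dual (linkCost r k) (by
    intro x y; unfold linkCost; split_ifs <;> omega)
  refine ⟨σ, hσ, ?_⟩
  obtain ⟨m, hm⟩ : ∃ m : ℤ, ∀ x, m ≤ - v x ∧ u x ≤ m + k := by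
    cases isEmpty_or_nonempty α
    · exact ⟨0, fun x => isEmptyElim x⟩
    · obtain ⟨z, hz⟩ := Finite.exists_min fun x => - v x
      refine ⟨- v z, fun x => ⟨hz x, ?_⟩⟩
      have h1 := hf x z
      have h2 : linkCost r k x z ≤ k := by unfold linkCost; split_ifs <;> omega
      omega
  let A : Fin k → Set α := fun j => {x | u x = m + j + 1 ∧ - v x = m + j}
  have hA : ∀ j, IsAntichain r (A j) := by
    rintro j x ⟨hx, -⟩ y ⟨-, hy⟩ hne hr
    have := hf x y
    simp only [linkCost, hne, hr, if_true, if_false] at this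
    omega
  have hU : (⋃ j, A j) = {x | u x + v x = 1} := by
    ext x
    simp only [Set.mem_iUnion, Set.mem_ofPred_eq, A]
    constructor
    · rintro ⟨j, h1, h2⟩; omega
    · intro h
      have := hm x
      exact ⟨⟨(- v x - m).toNat, by omega⟩, by simp only; omega, by simp only; omega⟩
  have hbij := Finite.injective_iff_bijective.1 hσ
  calc ∑ x, linkCost r k x (σ x) = ∑ x, (u x + v (σ x)) := by simp [he]
    _ = ∑ x, (u x + v x) := by
      rw [Finset.sum_add_distrib, Finset.sum_add_distrib, hbij.sum_comp v]
    _ ≤ ∑ x, if u x + v x = 1 then 1 else 0 := Finset.sum_le_sum fun x _ => by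
      have := hf x x
      simp only [linkCost, if_true] at this
      split_ifs <;> omega
    _ = ((⋃ j, A j).ncard : ℤ) := by
      rw [hU, Set.ncard_eq_toFinset_card']; simp
    _ ≤ dFam r k := by exact_mod_cast le_dFam hA

/-- The Greene–Kleitman theorem: `k`-saturated chain partitions exist. -/
theorem exists_saturated [IsPartialOrder α r] {k : ℕ} (hk : 0 < k) :
    ∃ f : α → α, IsChainPartition r f ∧ knorm f k = dFam r k := by
  classical
  obtain ⟨σ, hσ, hcost⟩ := exists_cost_le_dFam r hk
  have hex : ∀ x, ∃ n, ¬ (r (σ^[n] x) (σ^[n + 1] x) ∧ σ^[n] x ≠ σ^[n + 1] x) := by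
    intro x
    by_contra! h
    have hlt : ∀ n d, r (σ^[n] x) (σ^[n + d + 1] x) ∧ σ^[n] x ≠ σ^[n + d + 1] x := by
      intro n d
      induction d with
      | zero => exact h n
      | succ d ih =>
        have h1 := h (n + d + 1)
        refine ⟨trans_of r ih.1 h1.1, fun heq => ih.2 ?_⟩
        exact antisymm_of r ih.1 (heq ▸ h1.1)
    obtain ⟨n, m, hnm, hne⟩ :
        ∃ n m, σ^[n] x = σ^[m] x ∧ n < m := by
      have := not_injective_infinite_finite (fun n : ℕ => σ^[n] x)
      simp only [Function.Injective, not_forall] at this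
      obtain ⟨n, m, h1, h2⟩ := this
      rcases lt_or_gt_of_ne h2 with h3 | h3
      · exact ⟨n, m, h1, h3⟩
      · exact ⟨m, n, h1.symm, h3⟩
    have := hlt n (m - n - 1)
    rw [show n + (m - n - 1) + 1 = m by omega] at this
    exact this.2 hnm
  let N : α → ℕ := fun x => Nat.find (hex x)
  have hN : ∀ x, ∀ n < N x, r (σ^[n] x) (σ^[n + 1] x) ∧ σ^[n] x ≠ σ^[n + 1] x :=
    fun x n hn => not_not.1 (Nat.find_min (hex x) hn)
  have hmono : ∀ x, ∀ n ≤ N x, r x (σ^[n] x) := by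
    intro x n hn
    induction n with
    | zero => exact refl_of r _
    | succ n ih => exact trans_of r (ih (by omega)) (hN x n (by omega)).1
  let f : α → α := fun x => σ^[N x] x
  have htop : ∀ x, ¬ (r (f x) (σ (f x)) ∧ f x ≠ σ (f x)) := by
    intro x
    have := Nat.find_spec (hex x)
    rwa [Function.iterate_succ_apply'] at this
  have hf : IsChainPartition r f := by
    intro i x hx y hy _
    have key : ∀ x y, N x ≤ N y → f x = f y → r y x := by
      intro x y hle hxy
      have h1 : σ^[N x] x = σ^[N x] (σ^[N y - N x] y) := by
        rw [← Function.iterate_add_apply, Nat.add_sub_cancel' hle]; exact hxy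
      rw [hσ.iterate _ h1]
      exact hmono y _ (Nat.sub_le _ _)
    have hxy : f x = f y := by rw [show f x = i from hx, show f y = i from hy]
    rcases le_total (N x) (N y) with h | h
    · exact Or.inr (key x y h hxy)
    · exact Or.inl (key y x h hxy.symm)
  refine ⟨f, hf, le_antisymm ?_ (dFam_le_knorm hf k)⟩
  have : (knorm f k : ℤ) ≤ ∑ x, linkCost r k x (σ x) := by
    unfold knorm
    push_cast
    refine Finset.sum_le_sum fun i _ => ?_
    unfold linkCost
    split_ifs with h1 h2
    · refine (min_le_right _ _).trans ?_
      have : (f ⁻¹' {i}).ncard ≤ 1 := by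
        refine Set.ncard_le_one_iff_subsingleton.2 ?_
        have : ∀ x, f x = i → x = i := by
          intro x hx
          refine hσ.iterate (N x) ?_
          rw [Function.iterate_fixed h1.symm]
          exact hx
        intro x hx y hy
        rw [this x hx, this y hy]
      exact_mod_cast this
    · have : f ⁻¹' {i} = ∅ := by
        ext x
        simp only [Set.mem_preimage, Set.mem_singleton_iff, Set.mem_empty_iff_false, iff_false]
        rintro rfl
        exact htop x ⟨h2, h1⟩
      simp [this]
    · exact min_le_left _ _
  exact_mod_cast this.trans hcost

theorem dFam_concave {k : ℕ} [IsPartialOrder α r] :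
    dFam r k + dFam r (k + 2) ≤ 2 * dFam r (k + 1) := by
  obtain ⟨f, hf, hs⟩ := exists_saturated (r := r) k.succ_pos
  have h : knorm f k + knorm f (k + 2) ≤ 2 * knorm f (k + 1) := by
    unfold knorm
    rw [← Finset.sum_add_distrib, Finset.mul_sum]
    exact Finset.sum_le_sum fun i _ => by omega
  have := dFam_le_knorm hf k
  have := dFam_le_knorm hf (k + 2)
  simp only [Nat.succ_eq_add_one] at hs
  omega

theorem PolyunsatPO.dFam_strictConcave [IsPartialOrder α r] (hp : PolyunsatPO r) {k : ℕ}
    (hk : 0 < k) (hk' : k + 2 < heightPO r) :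
    dFam r k + dFam r (k + 2) < 2 * dFam r (k + 1) := by
  obtain ⟨f, hf, hs⟩ := exists_saturated (r := r) k.succ_pos
  have h : knorm f k + knorm f (k + 2) ≤ 2 * knorm f (k + 1) := by
    unfold knorm
    rw [← Finset.sum_add_distrib, Finset.mul_sum]
    exact Finset.sum_le_sum fun i _ => by omega
  have h1 := dFam_le_knorm hf k
  have h2 := dFam_le_knorm hf (k + 2)
  simp only [Nat.succ_eq_add_one] at hs
  by_contra hlt
  exact hp k (k + 2) hk (by omega) (by omega) hk' (by omega)
    ⟨f, hf, by omega, by omega⟩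

/-- A polyunsaturated poset has height at most its width plus two. -/
theorem PolyunsatPO.height_le [IsPartialOrder α r] (hp : PolyunsatPO r) :
    heightPO r ≤ widthPO r + 2 := by
  by_contra! hlt
  have hstep : ∀ j, j + 3 ≤ heightPO r →
      dFam r (heightPO r - 2 - j) + j + 1 ≤ dFam r (heightPO r - 1 - j) := by
    intro j
    induction j with
    | zero =>
      intro hj
      have := dFam_lt_succ (r := r) (k := heightPO r - 2) (by omega)
      rw [show heightPO r - 2 + 1 = heightPO r - 1 by omega] at this
      simpa using this
    | succ j ih =>
      intro hj
      have h1 := ih (by omega)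
      have h2 := hp.dFam_strictConcave (k := heightPO r - 3 - j) (by omega) (by omega)
      rw [show heightPO r - 3 - j + 2 = heightPO r - 1 - j by omega,
        show heightPO r - 3 - j + 1 = heightPO r - 2 - j by omega] at h2
      rw [show heightPO r - 2 - (j + 1) = heightPO r - 3 - j by omega,
        show heightPO r - 1 - (j + 1) = heightPO r - 2 - j by omega]
      omega
  have h1 := hstep (heightPO r - 3) (by omega)
  rw [show heightPO r - 2 - (heightPO r - 3) = 1 by omega,
    show heightPO r - 1 - (heightPO r - 3) = 2 by omega] at h1
  have h2 := dFam_concave (r := r) (k := 0)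
  have h3 := dFam_one_le r
  have h4 := dFam_zero r
  simp only [zero_add] at h2
  omega

end General

section ChainBounds

theorem exists_top_of_isChain {α : Type*} {r : α → α → Prop} [IsPartialOrder α r]
    {s : Finset α} (hs : IsChain r (s : Set α))
    (hne : s.Nonempty) : ∃ m ∈ s, ∀ x ∈ s, r x m := by
  classical
  induction hne using Finset.Nonempty.cons_induction with
  | singleton a => exact ⟨a, by simp, by simp [refl_of r a]⟩
  | cons a s ha hne ih =>
    obtain ⟨m, hm, htop⟩ := ih (hs.mono (by simp))
    have ham : a ≠ m := fun h => ha (h ▸ hm)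
    rcases hs (by simp) (by simp [hm]) ham with h | h
    · refine ⟨m, by simp [hm], fun x hx => ?_⟩
      rcases Finset.mem_cons.1 hx with rfl | hx
      · exact h
      · exact htop x hx
    · refine ⟨a, by simp, fun x hx => ?_⟩
      rcases Finset.mem_cons.1 hx with rfl | hx
      · exact refl_of r _
      · exact trans_of r (htop x hx) h

/-- If the potential `p` grows by at least the weight `w` along the order, then the weight of
any chain is bounded by any upper bound of `p`. -/
theorem sum_chain_le {α : Type*} {r : α → α → Prop} [IsPartialOrder α r]
    {w p : α → ℕ} {B : ℕ} (h0 : ∀ x, w x ≤ p x)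
    (hstep : ∀ x y, x ≠ y → r x y → p x + w y ≤ p y) (hB : ∀ x, p x ≤ B)
    {s : Finset α} (hs : IsChain r (s : Set α)) : ∑ x ∈ s, w x ≤ B := by
  classical
  have key : ∀ s : Finset α, IsChain r (s : Set α) → ∀ m ∈ s, (∀ x ∈ s, r x m) →
      ∑ x ∈ s, w x ≤ p m := by
    intro s
    induction s using Finset.strongInduction with
    | H s ih =>
      intro hs m hm htop
      rw [← Finset.sum_erase_add s w hm]
      rcases (s.erase m).eq_empty_or_nonempty with he | hne
      · simpa [he] using h0 m
      · have hs' : IsChain r (s.erase m : Set α) := hs.mono (by simp)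
        obtain ⟨m', hm', htop'⟩ := exists_top_of_isChain (by simpa using hs') hne
        have h1 := ih _ (Finset.erase_ssubset hm) (by simpa using hs') m' hm' htop'
        have h2 := hstep m' m (Finset.ne_of_mem_erase hm') (htop _ (Finset.mem_of_mem_erase hm'))
        omega
  rcases s.eq_empty_or_nonempty with rfl | hne
  · simp
  · obtain ⟨m, hm, htop⟩ := exists_top_of_isChain hs hne
    exact (key s hs m hm htop).trans (hB m)

variable {α : Type*} [Fintype α] {r : α → α → Prop}

/-- Disjoint long chains force every `k`-family to miss many elements. -/
theorem dFam_add_sum_card_le (k t : ℕ) (C : ℕ → Finset α)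
    (hC : ∀ i < t, IsChain r (C i : Set α))
    (hdisj : (Finset.range t : Set ℕ).PairwiseDisjoint C) :
    dFam r k + ∑ i ∈ Finset.range t, (C i).card ≤ Fintype.card α + t * k := by
  classical
  obtain ⟨A, hA, hk⟩ := exists_eq_dFam r k
  set F : Finset α := (⋃ i, A i).toFinset with hF
  have hFc : F.card = dFam r k := by rw [← hk, Set.ncard_eq_toFinset_card']
  have h1 : ∀ i ∈ Finset.range t, (C i).card ≤ (C i \ F).card + k := by
    intro i hi
    have h := ncard_inter_chain_le hA (hC i (Finset.mem_range.1 hi))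
    have h2 : ((C i : Set α) ∩ ⋃ i, A i).ncard = (C i ∩ F).card := by
      rw [← Set.ncard_coe_finset]; simp [F]
    have := Finset.card_sdiff_add_card_inter (C i) F
    omega
  have h2 : ∑ i ∈ Finset.range t, (C i \ F).card ≤ (Finset.univ \ F).card := by
    rw [← Finset.card_biUnion]
    · exact Finset.card_le_card fun x hx => by
        simp only [Finset.mem_biUnion, Finset.mem_sdiff] at hx
        obtain ⟨i, -, -, hx⟩ := hx
        simp [hx]
    · intro i hi j hj hij
      exact (hdisj hi hj hij).mono Finset.sdiff_subset Finset.sdiff_subset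
  have h3 := Finset.sum_le_sum h1
  rw [Finset.sum_add_distrib, Finset.sum_const, Finset.card_range, smul_eq_mul] at h3
  have h4 := Finset.card_sdiff_add_card_eq_card (Finset.subset_univ F)
  rw [Finset.card_univ] at h4
  omega

/-- A weight function taking values at most `2` bounds `m_k + m_l` from below. -/
theorem sum_weight_le_knorm_add [IsPartialOrder α r] {f : α → α} (hf : IsChainPartition r f)
    {k l : ℕ} (hkl : k ≤ l) {w : α → ℕ} (hw : ∀ x, w x ≤ 2)
    (hone : ∀ s : Finset α, IsChain r (s : Set α) → ∑ x ∈ s, (w x - 1) ≤ k)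
    (htwo : ∀ s : Finset α, IsChain r (s : Set α) → ∑ x ∈ s, w x ≤ k + l) :
    ∑ x, w x ≤ knorm f k + knorm f l := by
  classical
  unfold knorm
  rw [← Finset.sum_add_distrib, ← Finset.sum_fiberwise Finset.univ f w]
  refine Finset.sum_le_sum fun i _ => ?_
  have hs : IsChain r ((Finset.univ.filter fun x => f x = i : Finset α) : Set α) := by
    have := hf i
    convert this using 1
    ext x
    simp
  have hc : (f ⁻¹' {i}).ncard = (Finset.univ.filter fun x => f x = i).card := by
    rw [← Set.ncard_coe_finset]
    congr 1
    ext x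
    simp
  rw [hc]
  set s := Finset.univ.filter fun x => f x = i
  have h1 := hone s hs
  have h2 := htwo s hs
  have h3 : ∑ x ∈ s, w x ≤ ∑ x ∈ s, (w x - 1) + s.card := by
    rw [Finset.card_eq_sum_ones, ← Finset.sum_add_distrib]
    exact Finset.sum_le_sum fun x _ => by omega
  have h4 : ∑ x ∈ s, (w x - 1) ≤ s.card := by
    rw [Finset.card_eq_sum_ones]
    exact Finset.sum_le_sum fun x _ => by have := hw x; omega
  omega

end ChainBounds

/-- The order on `ℕ × ℕ` underlying the construction; `(i, j)` is the `j`-th element of the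
`i`-th column. -/
def colLE (x y : ℕ × ℕ) : Prop :=
  (x.1 = y.1 ∧ x.2 ≤ y.2) ∨ (x.1 < y.1 ∧ x.2 ≤ 1 ∧ 1 ≤ y.2)

/-- A second linear order which, together with the lexicographic one, realizes `colLE`. -/
def zigzagLE (x y : ℕ × ℕ) : Prop :=
  (x.2 = 0 ∧ y.2 = 0 ∧ y.1 ≤ x.1) ∨ (x.2 = 0 ∧ 1 ≤ y.2) ∨
    (x.2 = 1 ∧ y.2 = 1 ∧ x.1 ≤ y.1) ∨ (x.2 = 1 ∧ 2 ≤ y.2) ∨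
    (2 ≤ x.2 ∧ 2 ≤ y.2 ∧ (y.1 < x.1 ∨ (x.1 = y.1 ∧ x.2 ≤ y.2)))

/-- The lexicographic order on `ℕ × ℕ`. -/
def colLexLE (x y : ℕ × ℕ) : Prop :=
  x.1 < y.1 ∨ (x.1 = y.1 ∧ x.2 ≤ y.2)

theorem colLE_iff (x y : ℕ × ℕ) : colLE x y ↔ colLexLE x y ∧ zigzagLE x y := by
  unfold colLE colLexLE zigzagLE
  omega

section Columns

variable {α : Type*} {e : α → ℕ × ℕ}

theorem isPartialOrder_colLE (he : Function.Injective e) :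
    IsPartialOrder α fun x y => colLE (e x) (e y) where
  refl x := by unfold colLE; omega
  trans x y z := by unfold colLE; omega
  antisymm x y h1 h2 := he (by
    unfold colLE at h1 h2; ext <;> omega)

theorem dimLE2_colLE (he : Function.Injective e) :
    DimLE2 fun x y => colLE (e x) (e y) := by
  refine ⟨fun x y => colLexLE (e x) (e y), fun x y => zigzagLE (e x) (e y), ?_, ?_,
    fun x y h => ((colLE_iff _ _).1 h).1, fun x y h => ((colLE_iff _ _).1 h).2,
    fun x y => colLE_iff _ _⟩
  · exact
      { refl := fun x => by unfold colLexLE; omega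
        trans := fun x y z => by unfold colLexLE; omega
        antisymm := fun x y h1 h2 => he (by
          unfold colLexLE at h1 h2; ext <;> omega)
        total := fun x y => by unfold colLexLE; omega }
  · exact
      { refl := fun x => by unfold zigzagLE; omega
        trans := fun x y z => by unfold zigzagLE; omega
        antisymm := fun x y h1 h2 => he (by
          unfold zigzagLE at h1 h2; ext <;> omega)
        total := fun x y => by unfold zigzagLE; omega }

end Columns

section Weights

variable (h k l t u : ℕ)

/-- Weights certifying that no chain partition is both `k`- and `l`-saturated, where
`k + t = l + u = h + 1`. -/
def wt (x : ℕ × ℕ) : ℕ :=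
  if h ≤ x.1 then 2
  else if x.2 = 0 then (if x.1 + 1 < t then 1 else 2)
  else if x.2 = 1 then (if x.1 < u then 0 else if x.1 < t then 1 else 2)
  else if x.1 + 1 < u then (if x.2 ≤ k then 2 else if x.2 ≤ l + 1 then 1 else 0)
  else if x.1 + 1 < t then (if x.2 ≤ k + 1 then 2 else 1)
  else if x.1 + 1 = h then 1 else 2

/-- A potential for `wt`. -/
def wtPot (x : ℕ × ℕ) : ℕ :=
  if h ≤ x.1 then 2
  else if x.2 = 0 then (if x.1 + 1 < t then 1 else 2)
  else (if x.1 < u then 1 else if x.1 < t then x.1 + 2 - u else 2 * x.1 + 3 - t - u) +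
    (if x.1 + 1 < u then min (2 * (x.2 - 1)) (min (x.2 + k - 2) (l + k - 1))
    else if x.1 + 1 < t then min (2 * (x.2 - 1)) (x.2 - 1 + k)
    else if x.1 + 1 = h then x.2 - 1 else 2 * (x.2 - 1))

/-- A potential for the elements on which `wt` equals `2`. -/
def twoPot (x : ℕ × ℕ) : ℕ :=
  if h ≤ x.1 then 1
  else if x.1 + 1 < t then min (x.2 - 1) k
  else if x.2 = 0 then 1 else min (x.1 + x.2 + 1 - t) k

/-- The lengths of the columns of a poset of height `c`. -/
def colLen (c i : ℕ) : ℕ :=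
  if i + 3 < c then c - 1 - i else if i + 3 = c then 3 else if i = 0 then c else 1

variable {h k l t u}

theorem wt_le_two (x : ℕ × ℕ) : wt h k l t u x ≤ 2 := by
  unfold wt; split_ifs <;> omega

theorem wt_le_wtPot (hk : 1 ≤ k) (hkt : k + t = h + 1) (hut : u + 2 ≤ t) (x : ℕ × ℕ) :
    wt h k l t u x ≤ wtPot h k l t u x := by
  unfold wt wtPot; split_ifs <;> omega

theorem wtPot_le (hk : 1 ≤ k) (hkt : k + t = h + 1) (hlu : l + u = h + 1) (hut : u + 2 ≤ t)
    {x : ℕ × ℕ} (hx : x.2 < colLen (h + 2) x.1) : wtPot h k l t u x ≤ k + l := by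
  unfold colLen at hx
  unfold wtPot; split_ifs at hx ⊢ <;> omega

theorem wtPot_col_step (hk : 1 ≤ k) (hkt : k + t = h + 1) (hlu : l + u = h + 1)
    (hut : u + 2 ≤ t) {i j j' : ℕ} (hj : j < j') (hi : i < h) :
    wtPot h k l t u (i, j) + wt h k l t u (i, j') ≤ wtPot h k l t u (i, j') := by
  unfold wt wtPot
  by_cases e1 : h ≤ i <;> by_cases e2 : i + 1 < u <;> by_cases e3 : i < u <;>
    by_cases e4 : i + 1 < t <;> by_cases e5 : i < t <;> by_cases e6 : i + 1 = h <;>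
    first
    | omega
    | (simp only [e1, e2, e3, e4, e5, e6, if_true, if_false]
       first
       | omega
       | (split_ifs <;> omega))

theorem wtPot_row_step (hut : u + 2 ≤ t) {i i' : ℕ} (hii : i < i') (hi : i' < h) :
    wtPot h k l t u (i, 1) + wt h k l t u (i', 1) ≤ wtPot h k l t u (i', 1) := by
  unfold wt wtPot
  simp only [one_ne_zero, if_false, if_true, Nat.sub_self, mul_zero, Nat.zero_min, zero_add,
    ite_self, add_zero, show ¬ h ≤ i by omega, show ¬ h ≤ i' by omega]
  split_ifs <;> omega

/-- A monotonicity property along columns and along the second row extends to `colLE`. -/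
theorem potential_step (hh : 1 ≤ h) {p w : ℕ × ℕ → ℕ}
    (hcol : ∀ i j j', i < h → j < j' → j' < colLen (h + 2) i →
      p (i, j) + w (i, j') ≤ p (i, j'))
    (hrow : ∀ i i', i < i' → i' < h → p (i, 1) + w (i', 1) ≤ p (i', 1))
    {x y : ℕ × ℕ} (hx : x.2 < colLen (h + 2) x.1)
    (hy : y.2 < colLen (h + 2) y.1) (hne : x ≠ y) (hxy : colLE x y) :
    p x + w y ≤ p y := by
  obtain ⟨i, j⟩ := x
  obtain ⟨i', j'⟩ := y
  simp only [ne_eq, Prod.mk.injEq, not_and] at hne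
  unfold colLE at hxy
  simp only at *
  have hi' : i' < h := by
    by_contra hc
    unfold colLen at hx hy
    split_ifs at hx hy <;> omega
  rcases hxy with ⟨rfl, h2⟩ | ⟨h1, h2, h3⟩
  · exact hcol _ _ _ hi' (by have := hne rfl; omega) hy
  · have hj : p (i, j) ≤ p (i, 1) := by
      rcases Nat.le_one_iff_eq_zero_or_eq_one.1 h2 with rfl | rfl
      · have := hcol i 0 1 (by omega) one_pos (by unfold colLen; split_ifs <;> omega)
        omega
      · exact le_rfl
    have h4 := hrow i i' h1 hi'
    rcases h3.eq_or_lt with rfl | h3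
    · omega
    · have := hcol i' 1 j' hi' h3 hy
      omega

theorem wt_sub_one_le_twoPot (hk : 1 ≤ k) (hkt : k + t = h + 1) (hut : u + 2 ≤ t)
    (x : ℕ × ℕ) : wt h k l t u x - 1 ≤ twoPot h k t x := by
  unfold wt twoPot; split_ifs <;> omega

theorem twoPot_le (hk : 1 ≤ k) (x : ℕ × ℕ) : twoPot h k t x ≤ k := by
  unfold twoPot; split_ifs <;> omega

theorem twoPot_col_step (hk : 1 ≤ k) (hkt : k + t = h + 1) (hut : u + 2 ≤ t) {i j j' : ℕ}
    (hj : j < j') (hi : i < h) (hij : j' < colLen (h + 2) i) :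
    twoPot h k t (i, j) + (wt h k l t u (i, j') - 1) ≤ twoPot h k t (i, j') := by
  unfold colLen at hij
  unfold wt twoPot
  by_cases e1 : h ≤ i <;> by_cases e2 : i + 1 < u <;> by_cases e3 : i < u <;>
    by_cases e4 : i + 1 < t <;> by_cases e5 : i < t <;> by_cases e6 : i + 1 = h <;>
    first
    | omega
    | (simp only [e1, e2, e3, e4, e5, e6, if_true, if_false]
       split_ifs at hij ⊢ <;> omega)

theorem twoPot_row_step (hkt : k + t = h + 1) (hut : u + 2 ≤ t) {i i' : ℕ} (hii : i < i')
    (hi : i' < h) :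
    twoPot h k t (i, 1) + (wt h k l t u (i', 1) - 1) ≤ twoPot h k t (i', 1) := by
  unfold wt twoPot
  simp only [one_ne_zero, if_false, if_true, show ¬ h ≤ i by omega, show ¬ h ≤ i' by omega]
  split_ifs <;> omega

theorem sum_wt (hk : 1 ≤ k) (hkt : k + t = h + 1) (hlu : l + u = h + 1) (hut : u + 2 ≤ t)
    (i m : ℕ) :
    ∑ j ∈ Finset.range m, wt h k l t u (i, j) =
      if h ≤ i then 2 * m else
        (if i < u then min m 1 else if i + 1 < t then min m 2
          else if i < t then min m 1 + min m 2 else 2 * min m 2) +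
        (if i + 1 < u then min (2 * (m - 2)) (min (m - 2 + (k - 1)) (l + k - 1))
          else if i + 1 < t then min (2 * (m - 2)) (m - 2 + k)
          else if i + 1 = h then m - 2 else 2 * (m - 2)) := by
  induction m with
  | zero => simp
  | succ m ih =>
    rw [Finset.sum_range_succ, ih]
    unfold wt
    clear ih
    by_cases e1 : h ≤ i <;> by_cases e2 : i + 1 < u <;> by_cases e3 : i < u <;>
      by_cases e4 : i + 1 < t <;> by_cases e5 : i < t <;> by_cases e6 : i + 1 = h <;>
      first
      | omega
      | (simp only [e1, e2, e3, e4, e5, e6, if_true, if_false]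
         first
         | omega
         | (split_ifs <;> omega))

theorem two_mul_colLen_le (hk : 1 ≤ k) (hkt : k + t = h + 1) (hlu : l + u = h + 1)
    (hut : u + 2 ≤ t) (i : ℕ) :
    2 * colLen (h + 2) i ≤ ∑ j ∈ Finset.range (colLen (h + 2) i), wt h k l t u (i, j) +
      ((t - i) + (u - i) + if i = h - 1 then 1 else 0) := by
  rw [sum_wt hk hkt hlu hut]
  unfold colLen
  split_ifs <;> omega

end Weights

section Construction

/-- A chain in the construction which starts in column `s`, follows the second row up to column
`h - 1`, and ends with the third element of that column. -/
def longChain (h s m : ℕ) : ℕ × ℕ :=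
  if m = 0 then (s, 0) else if m ≤ h - s then (s + m - 1, 1) else (h - 1, 2)

variable {α : Type*} [Fintype α] {c a h : ℕ} {e : α → ℕ × ℕ}

open Classical in
/-- The elements whose coordinates are among `g 0, …, g (n - 1)`. -/
noncomputable def coordSet (e : α → ℕ × ℕ) (g : ℕ → ℕ × ℕ) (n : ℕ) : Finset α :=
  Finset.univ.filter fun x => ∃ m < n, g m = e x

theorem mem_coordSet {g : ℕ → ℕ × ℕ} {n : ℕ} {x : α} :
    x ∈ coordSet e g n ↔ ∃ m < n, g m = e x := by
  simp [coordSet]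

theorem isChain_coordSet {g : ℕ → ℕ × ℕ} {n : ℕ}
    (hg : ∀ m m', m < m' → m' < n → colLE (g m) (g m')) :
    IsChain (fun x y => colLE (e x) (e y)) (coordSet e g n : Set α) := by
  intro x hx y hy hxy
  obtain ⟨m, hm, hmx⟩ := mem_coordSet.1 hx
  obtain ⟨m', hm', hmy⟩ := mem_coordSet.1 hy
  simp only [← hmx, ← hmy]
  rcases lt_trichotomy m m' with hlt | rfl | hlt
  · exact Or.inl (hg _ _ hlt hm')
  · exact Or.inl (by unfold colLE; omega)
  · exact Or.inr (hg _ _ hlt hm)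

theorem card_coordSet (he : Function.Injective e) {g : ℕ → ℕ × ℕ} {n : ℕ}
    (hg : ∀ m m', m < m' → m' < n → g m ≠ g m') (hn : ∀ m < n, ∃ x, e x = g m) :
    (coordSet e g n).card = n := by
  classical
  rw [← Finset.card_image_of_injective _ he]
  have : (coordSet e g n).image e = (Finset.range n).image g := by
    ext p
    simp only [Finset.mem_image, mem_coordSet, Finset.mem_range]
    constructor
    · rintro ⟨x, ⟨m, hm, hx⟩, rfl⟩
      exact ⟨m, hm, hx⟩
    · rintro ⟨m, hm, rfl⟩
      obtain ⟨x, hx⟩ := hn m hm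
      exact ⟨x, ⟨m, hm, hx.symm⟩, hx⟩
  rw [this, Finset.card_image_of_injOn, Finset.card_range]
  intro m hm m' hm' heq
  simp only [Finset.coe_range, Set.mem_Iio] at hm hm'
  rcases lt_trichotomy m m' with hlt | rfl | hlt
  · exact absurd heq (hg _ _ hlt hm')
  · rfl
  · exact absurd heq.symm (hg _ _ hlt hm)

theorem longChain_step {s m m' n : ℕ} (hm : m < m') (hs : s < n) :
    colLE (longChain n s m) (longChain n s m') ∨ n + 2 - s ≤ m' := by
  unfold longChain colLE
  split_ifs <;> simp only [] <;> omega

theorem longChain_ne {s m m' n : ℕ} (hm : m < m') (hm' : m' < n + 2 - s) (hs : s < n) :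
    longChain n s m ≠ longChain n s m' := by
  unfold longChain
  split_ifs <;> simp only [ne_eq, Prod.mk.injEq] <;> omega

theorem longChain_mem {s m n : ℕ} (hs : s < n) (hn : n ≤ a) :
    (longChain n s m).1 < a ∧ (longChain n s m).2 < colLen (n + 2) (longChain n s m).1 := by
  unfold longChain colLen
  split_ifs <;> simp only [] at * <;> omega

theorem le_longChain_fst {s m n : ℕ} (hs : s < n) : s ≤ (longChain n s m).1 := by
  unfold longChain
  split_ifs <;> simp only [] <;> omega

theorem sum_coord (he : Function.Injective e)
    (hr : ∀ p, (∃ x, e x = p) ↔ p.1 < a ∧ p.2 < colLen c p.1) (w : ℕ × ℕ → ℕ) :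
    ∑ x, w (e x) = ∑ i ∈ Finset.range a, ∑ j ∈ Finset.range (colLen c i), w (i, j) := by
  rw [Finset.sum_sigma']
  refine Finset.sum_nbij (fun x => ⟨(e x).1, (e x).2⟩) ?_ ?_ ?_ ?_
  · intro x _
    simpa using (hr (e x)).1 ⟨x, rfl⟩
  · intro x _ y _ hxy
    simp only [Sigma.mk.injEq, heq_eq_eq] at hxy
    exact he (Prod.ext hxy.1 hxy.2)
  · rintro ⟨i, j⟩ hij
    obtain ⟨x, hx⟩ := (hr (i, j)).2 (by simpa using hij)
    exact ⟨x, by simp, by simp [hx]⟩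
  · simp

theorem dFam_colLE_le (he : Function.Injective e)
    (hr : ∀ p, (∃ x, e x = p) ↔ p.1 < a ∧ p.2 < colLen (h + 2) p.1) (hh : 1 ≤ h) (ha : h ≤ a)
    {k t : ℕ} (hk : 1 ≤ k) (hkt : k + t = h + 1) :
    dFam (fun x y => colLE (e x) (e y)) k + ∑ i ∈ Finset.range a, (t - i) + 1 ≤
      Fintype.card α := by
  obtain ⟨s, hs⟩ : ∃ s, s = t - 1 := ⟨_, rfl⟩
  set C : ℕ → Finset α := fun i =>
    if i < s then coordSet e (fun m => (i, m)) (h + 1 - i)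
    else coordSet e (longChain h s) (h + 2 - s) with hC
  have hmem : ∀ i < s + 1, ∀ x ∈ C i, (i < s ∧ (e x).1 = i) ∨ (i = s ∧ s ≤ (e x).1) := by
    intro i hi x hx
    by_cases his : i < s
    · simp only [hC, his, if_true, mem_coordSet] at hx
      obtain ⟨m, -, hx⟩ := hx
      exact Or.inl ⟨his, by rw [← hx]⟩
    · simp only [hC, his, if_false, mem_coordSet] at hx
      obtain ⟨m, -, hx⟩ := hx
      exact Or.inr ⟨by omega, by rw [← hx]; exact le_longChain_fst (by omega)⟩
  have hcard : ∀ i ∈ Finset.range (s + 1),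
      (C i).card = k + ((t - i) + if i = s then 1 else 0) := by
    intro i hi
    have hi := Finset.mem_range.1 hi
    by_cases his : i < s
    · simp only [hC, his, if_true]
      rw [card_coordSet he (g := fun m => (i, m))
        (fun m m' _ _ => by simp only [ne_eq, Prod.mk.injEq]; omega), if_neg (by omega)]
      · omega
      · intro m hm
        refine (hr _).2 ⟨by simp only []; omega, ?_⟩
        simp only [colLen]
        split_ifs <;> omega
    · simp only [hC, his, if_false]
      rw [card_coordSet he (fun m m' h1 h2 => longChain_ne h1 h2 (by omega))
        (fun m _ => (hr _).2 (longChain_mem (by omega) ha)), if_pos (by omega)]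
      omega
  have key := dFam_add_sum_card_le (r := fun x y => colLE (e x) (e y)) k (s + 1) C ?_ ?_
  · rw [Finset.sum_congr rfl hcard, Finset.sum_add_distrib, Finset.sum_add_distrib,
      Finset.sum_const, Finset.card_range, smul_eq_mul, Finset.sum_ite_eq',
      if_pos (by simp)] at key
    have hsum : ∑ i ∈ Finset.range (s + 1), (t - i) = ∑ i ∈ Finset.range a, (t - i) := by
      refine Finset.sum_subset (fun i hi => ?_) fun i _ hi => ?_
      · simp only [Finset.mem_range] at *
        omega
      · simp only [Finset.mem_range] at *
        omega
    omega
  · intro i hi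
    by_cases his : i < s
    · simp only [hC, his, if_true]
      exact isChain_coordSet fun m m' h1 _ => Or.inl ⟨rfl, h1.le⟩
    · simp only [hC, his, if_false]
      exact isChain_coordSet fun m m' h1 h2 =>
        (longChain_step h1 (by omega)).resolve_right (by omega)
  · intro i hi j hj hij
    simp only [Finset.coe_range, Set.mem_Iio] at hi hj
    refine Finset.disjoint_left.2 fun x hx hx' => ?_
    have h1 := hmem i hi x hx
    have h2 := hmem j hj x hx'
    omega

theorem heightPO_colLE (he : Function.Injective e)
    (hr : ∀ p, (∃ x, e x = p) ↔ p.1 < a ∧ p.2 < colLen c p.1) (hc : 0 < c) (ha : 0 < a)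
    (hca : c ≤ a + 2) : heightPO (fun x y => colLE (e x) (e y)) = c := by
  classical
  have := isPartialOrder_colLE he
  apply le_antisymm
  · obtain ⟨s, hs, hs'⟩ := exists_eq_heightPO fun x y => colLE (e x) (e y)
    rw [← hs', Set.ncard_eq_toFinset_card', Finset.card_eq_sum_ones]
    refine sum_chain_le (r := fun x y => colLE (e x) (e y)) (w := fun _ => 1)
      (p := fun x => (if (e x).2 = 0 then 0 else (e x).1 + (e x).2) + 1)
      (fun x => by omega) (fun x y hne hxy => ?_) (fun x => ?_) (by simpa using hs)
    · have : ¬ ((e x).1 = (e y).1 ∧ (e x).2 = (e y).2) :=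
        fun h => hne (he (Prod.ext h.1 h.2))
      unfold colLE at hxy
      split_ifs <;> omega
    · have := ((hr (e x)).1 ⟨x, rfl⟩).2
      unfold colLen at this
      split_ifs at * <;> omega
  · by_cases h3 : c ≤ 2
    · have h1 := le_heightPO (isChain_coordSet (e := e) (g := fun m => (0, m)) (n := c)
        fun m m' h _ => Or.inl ⟨rfl, h.le⟩)
      rwa [Set.ncard_coe_finset,
        card_coordSet he (g := fun m => (0, m))
        (fun m m' _ _ => by simp only [ne_eq, Prod.mk.injEq]; omega)] at h1
      intro m hm
      refine (hr _).2 ⟨ha, ?_⟩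
      simp only [colLen]
      split_ifs <;> omega
    · obtain ⟨n, rfl⟩ : ∃ n, c = n + 2 := ⟨c - 2, by omega⟩
      have h1 := le_heightPO (isChain_coordSet (e := e) (g := longChain n 0) (n := n + 2)
        fun m m' h _ => (longChain_step h (by omega)).resolve_right (by omega))
      rwa [Set.ncard_coe_finset, card_coordSet he (g := longChain n 0) (n := n + 2)
        (fun m m' h1 h2 => longChain_ne h1 h2 (by omega))
        (fun m _ => (hr _).2 (longChain_mem (by omega) (by omega)))] at h1

theorem widthPO_colLE (he : Function.Injective e)
    (hr : ∀ p, (∃ x, e x = p) ↔ p.1 < a ∧ p.2 < colLen c p.1) (hc : 0 < c) :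
    widthPO (fun x y => colLE (e x) (e y)) = a := by
  classical
  apply le_antisymm
  · obtain ⟨s, hs, hs'⟩ := exists_eq_widthPO fun x y => colLE (e x) (e y)
    rw [← hs', Set.ncard_eq_toFinset_card']
    calc s.toFinset.card ≤ (Finset.range a).card := by
          refine Finset.card_le_card_of_injOn (fun x => (e x).1)
            (fun x _ => by simpa using ((hr (e x)).1 ⟨x, rfl⟩).1) fun x hx y hy hxy => ?_
          simp only [Set.coe_toFinset] at hx hy
          by_contra hne
          have h1 := hs hx hy hne
          have h2 := hs hy hx (Ne.symm hne)
          simp only [Pi.compl_apply, compl_iff_not, colLE] at h1 h2 hxy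
          omega
      _ = a := Finset.card_range a
  · have h1 : IsAntichain (fun x y => colLE (e x) (e y))
        (coordSet e (fun m => (m, 0)) a : Set α) := by
      intro x hx y hy hne hxy
      obtain ⟨m, hm, hmx⟩ := mem_coordSet.1 hx
      obtain ⟨m', hm', hmy⟩ := mem_coordSet.1 hy
      simp only [← hmx, ← hmy, colLE] at hxy
      refine hne (he ?_)
      rw [← hmx, ← hmy, show m = m' by omega]
    have h2 := le_widthPO h1
    rwa [Set.ncard_coe_finset,
      card_coordSet he (g := fun m => (m, 0))
        (fun m m' _ _ => by simp only [ne_eq, Prod.mk.injEq]; omega)] at h2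
    intro m hm
    refine (hr _).2 ⟨hm, ?_⟩
    simp only [colLen]
    split_ifs <;> omega

theorem not_saturated_colLE (he : Function.Injective e)
    (hr : ∀ p, (∃ x, e x = p) ↔ p.1 < a ∧ p.2 < colLen (h + 2) p.1) (ha : h ≤ a)
    {k l : ℕ} (hk : 1 ≤ k) (hkl : k + 2 ≤ l) (hl : l ≤ h + 1) {f : α → α}
    (hf : IsChainPartition (fun x y => colLE (e x) (e y)) f) :
    dFam (fun x y => colLE (e x) (e y)) k + dFam (fun x y => colLE (e x) (e y)) l <
      knorm f k + knorm f l := by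
  have := isPartialOrder_colLE he
  obtain ⟨t, hkt⟩ : ∃ t, k + t = h + 1 := ⟨h + 1 - k, by omega⟩
  obtain ⟨u, hlu⟩ : ∃ u, l + u = h + 1 := ⟨h + 1 - l, by omega⟩
  have hut : u + 2 ≤ t := by omega
  have hx : ∀ x, (e x).2 < colLen (h + 2) (e x).1 := fun x => ((hr (e x)).1 ⟨x, rfl⟩).2
  have hw := sum_weight_le_knorm_add hf (show k ≤ l by omega)
    (w := fun x => wt h k l t u (e x)) (fun x => wt_le_two _)
    (fun s hs => sum_chain_le (r := fun x y => colLE (e x) (e y))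
      (p := fun x => twoPot h k t (e x)) (fun x => wt_sub_one_le_twoPot hk hkt hut _)
      (fun x y hne hxy => potential_step (by omega) (p := twoPot h k t)
        (w := fun x => wt h k l t u x - 1)
        (fun i j j' hi hj hij => twoPot_col_step hk hkt hut hj hi hij)
        (fun i i' hii hi => twoPot_row_step hkt hut hii hi) (hx x) (hx y) (he.ne hne) hxy)
      (fun x => twoPot_le hk _) hs)
    (fun s hs => sum_chain_le (r := fun x y => colLE (e x) (e y))
      (p := fun x => wtPot h k l t u (e x)) (fun x => wt_le_wtPot hk hkt hut _)
      (fun x y hne hxy => potential_step (by omega) (p := wtPot h k l t u)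
        (w := wt h k l t u)
        (fun i j j' hi hj _ => wtPot_col_step hk hkt hlu hut hj hi)
        (fun i i' hii hi => wtPot_row_step hut hii hi) (hx x) (hx y) (he.ne hne) hxy)
      (fun x => wtPot_le hk hkt hlu hut (hx x)) hs)
  have h1 := dFam_colLE_le he hr (by omega) ha hk hkt
  have h2 := dFam_colLE_le he hr (by omega) ha (show 1 ≤ l by omega) hlu
  have h3 := Finset.sum_le_sum fun i (_ : i ∈ Finset.range a) =>
    two_mul_colLen_le hk hkt hlu hut i
  have h4 : Fintype.card α = ∑ i ∈ Finset.range a, colLen (h + 2) i := by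
    have := sum_coord he hr fun _ => 1
    simpa using this
  rw [sum_coord he hr] at hw
  simp only [Finset.sum_add_distrib] at h3
  rw [Finset.sum_ite_eq', if_pos (by simp; omega), ← Finset.mul_sum] at h3
  omega

theorem polyunsatPO_colLE (he : Function.Injective e)
    (hr : ∀ p, (∃ x, e x = p) ↔ p.1 < a ∧ p.2 < colLen c p.1) (hc : 0 < c) (ha : 0 < a)
    (hca : c ≤ a + 2) : PolyunsatPO (fun x y => colLE (e x) (e y)) := by
  intro k l hk hl hkc hlc hkl
  rw [heightPO_colLE he hr hc ha hca] at hkc hlc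
  rintro ⟨f, hf, h1, h2⟩
  obtain ⟨n, rfl⟩ : ∃ n, c = n + 2 := ⟨c - 2, by omega⟩
  rcases hkl with hkl | hkl
  · have := not_saturated_colLE he hr (by omega) hk hkl (by omega) hf
    omega
  · have := not_saturated_colLE he hr (by omega) hl hkl (by omega) hf
    omega

theorem exists_coord (c a : ℕ) : ∃ (m : ℕ) (e : Fin m → ℕ × ℕ), Function.Injective e ∧
    ∀ p, (∃ x, e x = p) ↔ p.1 < a ∧ p.2 < colLen c p.1 := by
  let T := Σ i : Fin a, Fin (colLen c i)
  let g := (Fintype.equivFin T).symm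
  refine ⟨Fintype.card T, fun x => ((g x).1, (g x).2), ?_, ?_⟩
  · have : Function.Injective fun y : T => ((y.1 : ℕ), (y.2 : ℕ)) := by
      rintro ⟨⟨i, hi⟩, ⟨j, hj⟩⟩ ⟨⟨i', hi'⟩, ⟨j', hj'⟩⟩ hxy
      simp only [Prod.mk.injEq] at hxy
      obtain ⟨rfl, rfl⟩ := hxy
      rfl
    exact this.comp g.injective
  · rintro ⟨i, j⟩
    constructor
    · rintro ⟨x, hx⟩
      simp only [Prod.mk.injEq] at hx
      obtain ⟨rfl, rfl⟩ := hx
      exact ⟨(g x).1.2, (g x).2.2⟩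
    · rintro ⟨hi, hj⟩
      exact ⟨g.symm ⟨⟨i, hi⟩, ⟨j, hj⟩⟩, by
        simp only []
        rw [g.apply_symm_apply]⟩

end Construction

/-- For positive integers `c` and `a`: there is a polyunsaturated poset with height `c`
and width `a` iff `a ≥ c - 2`; moreover, in that case the poset may be required to have
order dimension at most 2. -/
theorem statement18 (c a : ℕ) (hc : 0 < c) (ha : 0 < a) :
    ((∃ (m : ℕ) (r : Fin m → Fin m → Prop),
        IsPartialOrder (Fin m) r ∧ heightPO r = c ∧ widthPO r = a ∧ PolyunsatPO r) ↔
      c ≤ a + 2) ∧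
    (c ≤ a + 2 →
      ∃ (m : ℕ) (r : Fin m → Fin m → Prop),
        IsPartialOrder (Fin m) r ∧ heightPO r = c ∧ widthPO r = a ∧ PolyunsatPO r ∧
        DimLE2 r) := by
  have key : c ≤ a + 2 → ∃ (m : ℕ) (r : Fin m → Fin m → Prop),
      IsPartialOrder (Fin m) r ∧ heightPO r = c ∧ widthPO r = a ∧ PolyunsatPO r ∧ DimLE2 r := by
    intro hca
    obtain ⟨m, e, he, hr⟩ := exists_coord c a
    exact ⟨m, fun x y => colLE (e x) (e y), isPartialOrder_colLE he,
      heightPO_colLE he hr hc ha hca, widthPO_colLE he hr hc,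
      polyunsatPO_colLE he hr hc ha hca, dimLE2_colLE he⟩
  refine ⟨⟨?_, fun hca => ?_⟩, key⟩
  · rintro ⟨m, r, hpo, rfl, rfl, hp⟩
    exact hp.height_le
  · obtain ⟨m, r, h1, h2, h3, h4, -⟩ := key hca
    exact ⟨m, r, h1, h2, h3, h4⟩
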